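/- Let 0 < q < 1, ν, γ ∈ ℂ with Re(γ) > -1 and Re(ν) > -1, x ∈ ℂ, and u in the q-lattice ℝ_{q,+}. Then ∫₀^x ρ^{ν+1} (q²ρ²/x²; q²)_γ J_ν(uρ; q²) d_q ρ = x^{ν-γ+1} u^{-γ-1} (1-q)(1-q²)^γ Γ_{q²}(γ+1) J_{γ+ν+1}(ux; q²). -/

import Mathlib

open scoped BigOperators
open Filter Topology

noncomputable section

/-- infinite q-Pochhammer symbol `(a;q)_∞` -/
def qPochInf (a q : ℂ) : ℂ := ∏' k : ℕ, (1 - a * q ^ k)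

/-- finite q-Pochhammer symbol `(a;q)_n` -/
def qPochFin (a q : ℂ) (n : ℕ) : ℂ := ∏ k ∈ Finset.range n, (1 - a * q ^ k)

/-- q-Pochhammer with complex exponent `(a;q)_μ = (a;q)_∞ / (a q^μ; q)_∞` -/
def qPochC (a q μ : ℂ) : ℂ := qPochInf a q / qPochInf (a * q ^ μ) q

/-- the third Jackson q-Bessel function `J_ν(z;q²)` -/
def qBessel (q : ℝ) (ν z : ℂ) : ℂ :=
  (qPochInf ((q:ℂ) ^ (2*ν+2)) ((q:ℂ)^(2:ℕ)) / qPochInf ((q:ℂ)^(2:ℕ)) ((q:ℂ)^(2:ℕ))) *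
    z ^ ν * ∑' n : ℕ, ((-1:ℂ)^n * (q:ℂ)^(n*(n+1)) * z^(2*n)) /
      (qPochFin ((q:ℂ)^(2:ℕ)) ((q:ℂ)^(2:ℕ)) n * qPochFin ((q:ℂ)^(2*ν+2)) ((q:ℂ)^(2:ℕ)) n)

/-- q-derivative `D_q f(z) = (f(z)-f(qz))/((1-q)z)` -/
def qDeriv (q : ℝ) (f : ℂ → ℂ) (z : ℂ) : ℂ := (f z - f ((q:ℂ)*z)) / ((1-(q:ℂ))*z)

/-- Jackson q-integral `∫₀^∞ f dq t` over the lattice `{q^k : k ∈ ℤ}` -/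
def jackson0Inf (q : ℝ) (f : ℂ → ℂ) : ℂ := (1-(q:ℂ)) * ∑' k : ℤ, (q:ℂ)^k * f ((q:ℂ)^k)

/-- Jackson q-integral `∫₀^x f dq t` -/
def jackson0X (q : ℝ) (x : ℂ) (f : ℂ → ℂ) : ℂ :=
  x*(1-(q:ℂ)) * ∑' n : ℕ, (q:ℂ)^n * f (x*(q:ℂ)^n)

/-- Jackson q-integral `∫_x^∞ f dq t = (1-q) Σ_{n≥1} x q^{-n} f(x q^{-n})` -/
def jacksonXInf (q : ℝ) (x : ℂ) (f : ℂ → ℂ) : ℂ :=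
  (1-(q:ℂ)) * ∑' n : ℕ, x*(q:ℂ)^(-(n:ℤ)-1) * f (x*(q:ℂ)^(-(n:ℤ)-1))

/-- the q-gamma function `Γ_q(x)` -/
def qGammaC (q : ℝ) (x : ℂ) : ℂ :=
  qPochInf (q:ℂ) (q:ℂ) * ((1-q : ℝ):ℂ)^(1-x) / qPochInf ((q:ℂ)^x) (q:ℂ)

lemma summable_norm_neg_mul_pow {p : ℂ} (hp : ‖p‖ < 1) (a : ℂ) :
    Summable fun k : ℕ => ‖-(a * p ^ k)‖ := by
  simpa [norm_mul, norm_pow] using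
    (summable_geometric_of_lt_one (norm_nonneg p) hp).mul_left ‖a‖

lemma multipliable_one_sub_mul_pow {p : ℂ} (hp : ‖p‖ < 1) (a : ℂ) :
    Multipliable fun k : ℕ => 1 - a * p ^ k := by
  simpa [sub_eq_add_neg] using
    multipliable_one_add_of_summable (summable_norm_neg_mul_pow hp a)

lemma one_sub_mul_pow_ne_zero {p a : ℂ} (hp : ‖p‖ < 1) (ha : ‖a‖ < 1) (k : ℕ) :
    1 - a * p ^ k ≠ 0 := by
  intro h
  have h1 : ‖a * p ^ k‖ = 1 := by rw [← sub_eq_zero.mp h, norm_one]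
  have h2 : ‖a * p ^ k‖ < 1 := by
    rw [norm_mul, norm_pow]
    exact (mul_le_of_le_one_right (norm_nonneg a)
      (pow_le_one₀ (norm_nonneg p) hp.le)).trans_lt ha
  exact h2.ne h1

lemma qPochInf_ne_zero {p a : ℂ} (hp : ‖p‖ < 1) (ha : ‖a‖ < 1) : qPochInf a p ≠ 0 := by
  have := tprod_one_add_ne_zero_of_summable (f := fun k : ℕ => -(a * p ^ k))
    (fun k => by simpa [sub_eq_add_neg] using one_sub_mul_pow_ne_zero hp ha k)
    (summable_norm_neg_mul_pow hp a)
  simpa [qPochInf, sub_eq_add_neg] using this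

lemma qPochFin_ne_zero {p a : ℂ} (hp : ‖p‖ < 1) (ha : ‖a‖ < 1) (n : ℕ) : qPochFin a p n ≠ 0 :=
  Finset.prod_ne_zero_iff.mpr fun k _ => one_sub_mul_pow_ne_zero hp ha k

lemma qPochFin_mul_qPochInf {p : ℂ} (hp : ‖p‖ < 1) (a : ℂ) (n : ℕ) :
    qPochFin a p n * qPochInf (a * p ^ n) p = qPochInf a p := by
  have h := Multipliable.prod_mul_tprod_nat_mul' (f := fun k : ℕ => 1 - a * p ^ k) (k := n)
    (by simpa [pow_add, mul_assoc, mul_comm, mul_left_comm] using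
      multipliable_one_sub_mul_pow hp (a * p ^ n))
  rw [qPochInf, qPochInf, qPochFin, ← h]
  simp only [pow_add, mul_assoc, mul_comm]

lemma tendsto_qPochFin {p : ℂ} (hp : ‖p‖ < 1) (a : ℂ) :
    Tendsto (qPochFin a p) atTop (𝓝 (qPochInf a p)) :=
  (multipliable_one_sub_mul_pow hp a).tendsto_prod_tprod_nat

lemma exists_norm_qPochFin_div_le {p : ℂ} (hp : ‖p‖ < 1) (a : ℂ) {b : ℂ} (hb : ‖b‖ < 1) :
    ∃ M : ℝ, ∀ n, ‖qPochFin a p n / qPochFin b p n‖ ≤ M := by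
  obtain ⟨M, hM⟩ := ((tendsto_qPochFin hp a).div (tendsto_qPochFin hp b)
    (qPochInf_ne_zero hp hb)).norm.bddAbove_range
  exact ⟨M, fun n => hM ⟨n, rfl⟩⟩

lemma qPochFin_zero_left (p : ℂ) (n : ℕ) : qPochFin 0 p n = 1 := by simp [qPochFin]

lemma qPochFin_zero (a p : ℂ) : qPochFin a p 0 = 1 := by simp [qPochFin]

lemma qPochFin_succ (a p : ℂ) (n : ℕ) :
    qPochFin a p (n + 1) = qPochFin a p n * (1 - a * p ^ n) := Finset.prod_range_succ _ _

/-- The series `∑ (a;p)_n / (p;p)_n t^n`. -/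
def qBinomialSeries (a p t : ℂ) : ℂ := ∑' n : ℕ, qPochFin a p n / qPochFin p p n * t ^ n

lemma summable_qBinomialSeries {p : ℂ} (hp : ‖p‖ < 1) (a : ℂ) {t : ℂ} (ht : ‖t‖ < 1) :
    Summable fun n : ℕ => qPochFin a p n / qPochFin p p n * t ^ n := by
  obtain ⟨M, hM⟩ := exists_norm_qPochFin_div_le hp a hp
  refine Summable.of_norm_bounded
    ((summable_geometric_of_lt_one (norm_nonneg t) ht).mul_left M) fun n => ?_
  rw [norm_mul, norm_pow]
  exact mul_le_mul_of_nonneg_right (hM n) (by positivity)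

lemma norm_mul_pow_lt_one {p t : ℂ} (hp : ‖p‖ < 1) (ht : ‖t‖ < 1) (n : ℕ) : ‖t * p ^ n‖ < 1 := by
  rw [norm_mul, norm_pow]
  exact (mul_le_of_le_one_right (norm_nonneg t)
    (pow_le_one₀ (norm_nonneg p) hp.le)).trans_lt ht

lemma one_sub_mul_qBinomialSeries {p : ℂ} (hp : ‖p‖ < 1) (a : ℂ) {t : ℂ} (ht : ‖t‖ < 1) :
    (1 - t) * qBinomialSeries a p t = (1 - a * t) * qBinomialSeries a p (t * p) := by
  set c : ℕ → ℂ := fun n => qPochFin a p n / qPochFin p p n with hc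
  have htp : ‖t * p‖ < 1 := by simpa using norm_mul_pow_lt_one hp ht 1
  have h1 : Summable fun n => c n * t ^ n := summable_qBinomialSeries hp a ht
  have h2 : Summable fun n => c n * (t * p) ^ n := summable_qBinomialSeries hp a htp
  have hrec : ∀ n, c (n + 1) * (1 - p ^ (n + 1)) = c n * (1 - a * p ^ n) := by
    intro n
    have e1 := qPochFin_ne_zero hp hp n
    have e2 := one_sub_mul_pow_ne_zero hp hp n
    simp only [hc, qPochFin_succ]
    rw [pow_succ', div_mul_eq_mul_div, div_mul_eq_mul_div, div_eq_div_iff (mul_ne_zero e1 e2) e1]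
    ring
  have key : (∑' n, c n * t ^ n) - ∑' n, c n * (t * p) ^ n =
      t * (∑' n, c n * t ^ n) - a * t * ∑' n, c n * (t * p) ^ n := by
    rw [← h1.tsum_sub h2, ← tsum_mul_left, ← tsum_mul_left,
      ← (h1.mul_left t).tsum_sub (h2.mul_left (a * t)), (h1.sub h2).tsum_eq_zero_add]
    simp only [pow_zero, mul_one, sub_self, zero_add]
    refine tsum_congr fun n => ?_
    linear_combination (t ^ (n + 1)) * hrec n
  simp only [qBinomialSeries]
  linear_combination key

lemma qPochFin_mul_qBinomialSeries {p : ℂ} (hp : ‖p‖ < 1) (a : ℂ) {t : ℂ} (ht : ‖t‖ < 1) (n : ℕ) :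
    qPochFin t p n * qBinomialSeries a p t =
      qPochFin (a * t) p n * qBinomialSeries a p (t * p ^ n) := by
  induction n with
  | zero => simp [qPochFin]
  | succ n ih =>
    have h := one_sub_mul_qBinomialSeries hp a (norm_mul_pow_lt_one hp ht n)
    rw [qPochFin_succ, qPochFin_succ, pow_succ, ← mul_assoc t]
    linear_combination (1 - t * p ^ n) * ih + qPochFin (a * t) p n * h

lemma tendsto_qBinomialSeries {p : ℂ} (hp : ‖p‖ < 1) (a : ℂ) {t : ℂ} (ht : ‖t‖ < 1) :
    Tendsto (fun n : ℕ => qBinomialSeries a p (t * p ^ n)) atTop (𝓝 1) := by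
  obtain ⟨M, hM⟩ := exists_norm_qPochFin_div_le hp a hp
  have h := tendsto_tsum_of_dominated_convergence (𝓕 := atTop)
    (f := fun (n k : ℕ) => qPochFin a p k / qPochFin p p k * (t * p ^ n) ^ k)
    (g := fun k => qPochFin a p k / qPochFin p p k * 0 ^ k) (bound := fun k => M * ‖t‖ ^ k)
    ((summable_geometric_of_lt_one (norm_nonneg t) ht).mul_left M) ?_ ?_
  · rw [tsum_eq_single 0 (by intro k hk; simp [hk])] at h
    simpa [qBinomialSeries, qPochFin_zero] using h
  · intro k
    have : Tendsto (fun n : ℕ => t * p ^ n) atTop (𝓝 0) := by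
      simpa using (tendsto_pow_atTop_nhds_zero_of_norm_lt_one hp).const_mul t
    exact (this.pow k).const_mul _
  · refine Eventually.of_forall fun n k => ?_
    rw [norm_mul, norm_pow]
    have : ‖t * p ^ n‖ ≤ ‖t‖ := by
      rw [norm_mul, norm_pow]
      exact mul_le_of_le_one_right (norm_nonneg t) (pow_le_one₀ (norm_nonneg p) hp.le)
    exact mul_le_mul (hM k) (pow_le_pow_left₀ (norm_nonneg _) this k) (by positivity)
      ((norm_nonneg _).trans (hM k))

/-- The `q`-binomial theorem. -/
theorem qBinomialSeries_eq {p : ℂ} (hp : ‖p‖ < 1) (a : ℂ) {t : ℂ} (ht : ‖t‖ < 1) :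
    qBinomialSeries a p t = qPochInf (a * t) p / qPochInf t p := by
  rw [eq_div_iff (qPochInf_ne_zero hp ht), mul_comm]
  refine tendsto_nhds_unique ((tendsto_qPochFin hp t).mul_const _) ?_
  simp_rw [qPochFin_mul_qBinomialSeries hp a ht]
  simpa using (tendsto_qPochFin hp (a * t)).mul (tendsto_qBinomialSeries hp a ht)

lemma qPochInf_mul_pow_div {p a b : ℂ} (hp : ‖p‖ < 1) (ha : ‖a‖ < 1) (hb : ‖b‖ < 1) (n : ℕ) :
    qPochInf (b * p ^ n) p / qPochInf (a * p ^ n) p =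
      qPochInf b p / qPochInf a p * (qPochFin a p n / qPochFin b p n) := by
  rw [← qPochFin_mul_qPochInf hp a n, ← qPochFin_mul_qPochInf hp b n]
  have h1 := qPochFin_ne_zero hp ha n
  have h2 := qPochFin_ne_zero hp hb n
  have h3 := qPochInf_ne_zero hp (norm_mul_pow_lt_one hp ha n)
  field_simp

/-- Integrating a power series term by term against the weight `(p^{n+1};p)_∞ / (a p^n;p)_∞`. -/
lemma tsum_qPochInf_div_mul_tsum {p a b : ℂ} (hp : ‖p‖ < 1) (ha : ‖a‖ < 1) (hb : ‖b‖ < 1)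
    {e : ℕ → ℂ} (he : Summable fun m => ‖e m‖) :
    ∑' n : ℕ, b ^ n * (qPochInf (p * p ^ n) p / qPochInf (a * p ^ n) p) *
        ∑' m : ℕ, e m * (p ^ n) ^ m =
      qPochInf p p / qPochInf a p *
        ∑' m : ℕ, e m * (qPochInf (a * b * p ^ m) p / qPochInf (b * p ^ m) p) := by
  obtain ⟨M, hM⟩ := exists_norm_qPochFin_div_le hp a hp
  have hs : Summable fun x : ℕ × ℕ =>
      b ^ x.1 * (qPochFin a p x.1 / qPochFin p p x.1) * (e x.2 * (p ^ x.1) ^ x.2) := by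
    refine Summable.of_norm_bounded (g := fun x : ℕ × ℕ => (M * ‖b‖ ^ x.1) * ‖e x.2‖)
      (((summable_geometric_of_lt_one (norm_nonneg b) hb).mul_left M).mul_of_nonneg he
        (fun n => mul_nonneg ((norm_nonneg _).trans (hM 0)) (by positivity))
        fun m => norm_nonneg _) fun x => ?_
    have h1 : ‖(p ^ x.1) ^ x.2‖ ≤ 1 := by
      rw [norm_pow, norm_pow]
      exact pow_le_one₀ (by positivity) (pow_le_one₀ (norm_nonneg p) hp.le)
    rw [norm_mul, norm_mul, norm_mul, norm_pow, mul_comm (‖b‖ ^ _)]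
    exact mul_le_mul (mul_le_mul_of_nonneg_right (hM _) (by positivity))
      (mul_le_of_le_one_right (norm_nonneg _) h1) (by positivity)
      (mul_nonneg ((norm_nonneg _).trans (hM 0)) (by positivity))
  calc
    _ = qPochInf p p / qPochInf a p * ∑' n : ℕ, ∑' m : ℕ,
        b ^ n * (qPochFin a p n / qPochFin p p n) * (e m * (p ^ n) ^ m) := by
      rw [← tsum_mul_left]
      refine tsum_congr fun n => ?_
      rw [tsum_mul_left, qPochInf_mul_pow_div hp ha hp]
      ring
    _ = _ := by
      rw [← Summable.tsum_comm (f := fun n m : ℕ =>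
        b ^ n * (qPochFin a p n / qPochFin p p n) * (e m * (p ^ n) ^ m)) hs]
      congr 1
      refine tsum_congr fun m => ?_
      have h := qBinomialSeries_eq hp a (norm_mul_pow_lt_one hp hb m)
      rw [← mul_assoc] at h
      rw [← h, qBinomialSeries, ← tsum_mul_left]
      refine tsum_congr fun n => ?_
      rw [mul_pow, ← pow_mul, ← pow_mul, mul_comm n m]
      ring

lemma summable_norm_qBessel_term {p b : ℂ} (hp : ‖p‖ < 1) (hb : ‖b‖ < 1) {q : ℝ}
    (hq0 : 0 < q) (hq1 : q < 1) (z : ℂ) :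
    Summable fun n : ℕ => ‖((-1 : ℂ) ^ n * (q : ℂ) ^ (n * (n + 1)) * z ^ (2 * n)) /
      (qPochFin p p n * qPochFin b p n)‖ := by
  obtain ⟨M, hM⟩ := exists_norm_qPochFin_div_le hp 0 hp
  obtain ⟨N, hN⟩ := exists_norm_qPochFin_div_le hp 0 hb
  simp only [qPochFin_zero_left] at hM hN
  have hsum : Summable fun n : ℕ => q ^ (n * (n + 1)) * ‖z‖ ^ (2 * n) := by
    rcases eq_or_ne z 0 with rfl | hz
    · refine summable_of_ne_finset_zero (s := {0}) fun n hn => ?_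
      have : n ≠ 0 := by simpa using hn
      simp [this]
    · have hz' : 0 < ‖z‖ := norm_pos_iff.mpr hz
      refine summable_of_ratio_test_tendsto_lt_one (l := 0) one_pos
        (Eventually.of_forall fun n => by positivity) ?_
      have h : Tendsto (fun n : ℕ => q ^ 2 * ‖z‖ ^ 2 * (q ^ 2) ^ n) atTop (𝓝 0) := by
        simpa using (tendsto_pow_atTop_nhds_zero_of_lt_one (by positivity)
          (pow_lt_one₀ hq0.le hq1 two_ne_zero)).const_mul (q ^ 2 * ‖z‖ ^ 2)
      refine h.congr fun n => ?_
      rw [Real.norm_of_nonneg (by positivity), Real.norm_of_nonneg (by positivity),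
        eq_div_iff (by positivity)]
      ring
  refine Summable.of_nonneg_of_le (fun _ => norm_nonneg _) (fun n => ?_) (hsum.mul_left (M * N))
  have e : ((-1 : ℂ) ^ n * (q : ℂ) ^ (n * (n + 1)) * z ^ (2 * n)) /
      (qPochFin p p n * qPochFin b p n) = (1 / qPochFin p p n) * (1 / qPochFin b p n) *
        ((-1 : ℂ) ^ n * (q : ℂ) ^ (n * (n + 1)) * z ^ (2 * n)) := by ring
  have e' : ‖((-1 : ℂ) ^ n * (q : ℂ) ^ (n * (n + 1)) * z ^ (2 * n))‖ =
      q ^ (n * (n + 1)) * ‖z‖ ^ (2 * n) := by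
    simp [abs_of_pos hq0]
  rw [e, norm_mul, norm_mul, e']
  exact mul_le_mul_of_nonneg_right
    (mul_le_mul (hM n) (hN n) (norm_nonneg _) ((norm_nonneg _).trans (hM n))) (by positivity)

lemma ofReal_mul_cpow {r : ℝ} (hr : 0 < r) (x s : ℂ) :
    ((r : ℂ) * x) ^ s = (r : ℂ) ^ s * x ^ s := by
  have hr' : (r : ℂ) ≠ 0 := Complex.ofReal_ne_zero.mpr hr.ne'
  rcases eq_or_ne x 0 with rfl | hx
  · rcases eq_or_ne s 0 with rfl | hs
    · simp
    · simp [hs]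
  · rw [Complex.cpow_def_of_ne_zero (mul_ne_zero hr' hx), Complex.cpow_def_of_ne_zero hr',
      Complex.cpow_def_of_ne_zero hx, Complex.log_ofReal_mul hr hx, ← Complex.exp_add,
      Complex.ofReal_log hr.le, add_mul]

lemma ofReal_pow_cpow {r : ℝ} (hr : 0 < r) (n : ℕ) (s : ℂ) :
    ((r : ℂ) ^ n) ^ s = ((r : ℂ) ^ s) ^ n := by
  induction n with
  | zero => simp
  | succ n ih => rw [pow_succ', ofReal_mul_cpow hr, ih, pow_succ']

lemma norm_ofReal_cpow_lt_one {q : ℝ} (hq0 : 0 < q) (hq1 : q < 1) {s : ℂ} (hs : 0 < s.re) :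
    ‖(q : ℂ) ^ s‖ < 1 := by
  rw [Complex.norm_cpow_eq_rpow_re_of_pos hq0]
  exact Real.rpow_lt_one hq0.le hq1 hs

theorem stmt_5 (q : ℝ) (hq0 : 0 < q) (hq1 : q < 1) (ν γ : ℂ)
    (hγ : -1 < γ.re) (hν : -1 < ν.re) (x : ℂ) (u : ℝ) (hu : ∃ k : ℤ, u = q ^ k) :
    jackson0X q x (fun ρ => ρ^(ν+1) * qPochC ((q:ℂ)^2*ρ^2/x^2) ((q:ℂ)^(2:ℕ)) γ *
        qBessel q ν ((u:ℂ)*ρ)) =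
      x^(ν-γ+1) * (u:ℂ)^(-γ-1) * (1-(q:ℂ)) * ((1 - q^2 : ℝ):ℂ)^γ *
        qGammaC (q^2) (γ+1) * qBessel q (γ+ν+1) ((u:ℂ)*x) := by
  obtain ⟨k, hk⟩ := hu
  have hu0 : 0 < u := hk ▸ zpow_pos hq0 k
  rcases eq_or_ne x 0 with rfl | hx
  · rcases eq_or_ne (γ + ν + 1) 0 with h | h
    · have h' : ν - γ + 1 ≠ 0 := by
        intro h2
        have := congrArg Complex.re (show 2 * ν + 2 = 0 by linear_combination h + h2)
        simp at this
        linarith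
      simp [jackson0X, Complex.zero_cpow h']
    · simp [jackson0X, qBessel, Complex.zero_cpow h]
  have hqc : (q : ℂ) ≠ 0 := Complex.ofReal_ne_zero.mpr hq0.ne'
  have huc : (u : ℂ) ≠ 0 := Complex.ofReal_ne_zero.mpr hu0.ne'
  have h1q : ((1 - q ^ 2 : ℝ) : ℂ) ≠ 0 :=
    Complex.ofReal_ne_zero.mpr (sub_pos.mpr (pow_lt_one₀ hq0.le hq1 two_ne_zero)).ne'
  set p : ℂ := (q : ℂ) ^ (2 : ℕ) with hp_def
  set a : ℂ := (q : ℂ) ^ (2 * γ + 2) with ha_def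
  set b : ℂ := (q : ℂ) ^ (2 * ν + 2) with hb_def
  have hp : ‖p‖ < 1 := by
    rw [hp_def, norm_pow, Complex.norm_of_nonneg hq0.le]
    exact pow_lt_one₀ hq0.le hq1 two_ne_zero
  have ha : ‖a‖ < 1 := norm_ofReal_cpow_lt_one hq0 hq1 (by simp; linarith)
  have hb : ‖b‖ < 1 := norm_ofReal_cpow_lt_one hq0 hq1 (by simp; linarith)
  have hab : ‖a * b‖ < 1 := by
    rw [norm_mul]
    exact mul_lt_one_of_nonneg_of_lt_one_left (norm_nonneg a) ha hb.le
  have hab_eq : (q : ℂ) ^ (2 * (γ + ν + 1) + 2) = a * b := by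
    rw [ha_def, hb_def, ← Complex.cpow_add _ _ hqc]
    congr 1
    ring
  have hpcpow (s : ℂ) : p ^ s = (q : ℂ) ^ (2 * s) := by
    rw [hp_def, ofReal_pow_cpow hq0, sq, ← Complex.cpow_add _ _ hqc, two_mul]
  have hpγ : p * p ^ γ = a := by
    rw [hpcpow, hp_def, ha_def, Complex.cpow_add _ _ hqc, mul_comm]
    norm_cast
  have hpγ' : p ^ (γ + 1) = a := by
    rw [hpcpow, ha_def]
    congr 1
    ring
  set e : ℕ → ℂ := fun m => ((-1 : ℂ) ^ m * (q : ℂ) ^ (m * (m + 1)) * ((u : ℂ) * x) ^ (2 * m)) /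
      (qPochFin p p m * qPochFin b p m) with he_def
  have he : Summable fun m => ‖e m‖ := summable_norm_qBessel_term hp hb hq0 hq1 _
  have hterm (n : ℕ) : (q : ℂ) ^ n * ((x * (q : ℂ) ^ n) ^ (ν + 1) *
      qPochC (p * (x * (q : ℂ) ^ n) ^ 2 / x ^ 2) p γ *
        qBessel q ν ((u : ℂ) * (x * (q : ℂ) ^ n))) =
      x ^ (ν + 1) * x ^ ν * (u : ℂ) ^ ν * (qPochInf b p / qPochInf p p) *
        (b ^ n * (qPochInf (p * p ^ n) p / qPochInf (a * p ^ n) p) *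
          ∑' m : ℕ, e m * (p ^ n) ^ m) := by
    have hr : (0 : ℝ) < q ^ n := pow_pos hq0 n
    have hrc : (q : ℂ) ^ n ≠ 0 := pow_ne_zero n hqc
    have c1 (s : ℂ) : (x * (q : ℂ) ^ n) ^ s = ((q : ℂ) ^ n) ^ s * x ^ s := by
      rw [mul_comm, ← Complex.ofReal_pow, ofReal_mul_cpow hr]
    have c2 : (q : ℂ) ^ n * ((q : ℂ) ^ n) ^ (ν + 1) * ((q : ℂ) ^ n) ^ ν = b ^ n := by
      rw [hb_def, ← ofReal_pow_cpow hq0, show 2 * ν + 2 = 1 + (ν + 1) + ν by ring,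
        Complex.cpow_add (1 + (ν + 1)) ν hrc, Complex.cpow_add 1 (ν + 1) hrc, Complex.cpow_one]
    have c3 : p * (x * (q : ℂ) ^ n) ^ 2 / x ^ 2 = p * p ^ n := by
      rw [hp_def]
      field_simp
      ring
    have c4 : p * p ^ n * p ^ γ = a * p ^ n := by rw [← hpγ]; ring
    have c5 (m : ℕ) : ((-1 : ℂ) ^ m * (q : ℂ) ^ (m * (m + 1)) *
        ((u : ℂ) * (x * (q : ℂ) ^ n)) ^ (2 * m)) / (qPochFin p p m * qPochFin b p m) =
        e m * (p ^ n) ^ m := by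
      simp only [he_def, hp_def]
      ring
    rw [qPochC, qBessel, c3, c4, ofReal_mul_cpow hu0, c1, c1, ← c2]
    simp only [← hp_def, ← hb_def, c5]
    ring
  have hsum : ∑' m : ℕ, e m * (qPochInf (a * b * p ^ m) p / qPochInf (b * p ^ m) p) =
      qPochInf (a * b) p / qPochInf b p *
        ∑' m : ℕ, ((-1 : ℂ) ^ m * (q : ℂ) ^ (m * (m + 1)) * ((u : ℂ) * x) ^ (2 * m)) /
          (qPochFin p p m * qPochFin (a * b) p m) := by
    rw [← tsum_mul_left]
    refine tsum_congr fun m => ?_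
    rw [qPochInf_mul_pow_div hp hb hab]
    have h1 := qPochFin_ne_zero hp hb m
    simp only [he_def]
    field_simp
  have hA := qPochInf_ne_zero hp hb
  have hP := qPochInf_ne_zero hp hp
  have hpow : x * (x ^ (ν + 1) * x ^ ν) = x ^ (ν - γ + 1) * x ^ (γ + ν + 1) := by
    nth_rewrite 1 [← Complex.cpow_one x]
    simp only [← Complex.cpow_add _ _ hx]
    congr 1
    ring
  have hupow : (u : ℂ) ^ ν = (u : ℂ) ^ (-γ - 1) * (u : ℂ) ^ (γ + ν + 1) := by
    rw [← Complex.cpow_add _ _ huc]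
    congr 1
    ring
  have hγpow : ((1 - q ^ 2 : ℝ) : ℂ) ^ γ * ((1 - q ^ 2 : ℝ) : ℂ) ^ (1 - (γ + 1)) = 1 := by
    rw [← Complex.cpow_add _ _ h1q, show γ + (1 - (γ + 1)) = 0 by ring, Complex.cpow_zero]
  have hqp : ((q ^ 2 : ℝ) : ℂ) = p := by rw [hp_def]; push_cast; rfl
  rw [jackson0X]
  simp only [hterm]
  rw [tsum_mul_left, tsum_qPochInf_div_mul_tsum hp ha hb he, hsum, qGammaC, qBessel, hab_eq, hqp,
    hpγ', ofReal_mul_cpow hu0, hupow]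
  set S := ∑' m : ℕ, ((-1 : ℂ) ^ m * (q : ℂ) ^ (m * (m + 1)) * ((u : ℂ) * x) ^ (2 * m)) /
          (qPochFin p p m * qPochFin (a * b) p m)
  calc
    _ = (x * (x ^ (ν + 1) * x ^ ν)) * ((u : ℂ) ^ (-γ - 1) * (u : ℂ) ^ (γ + ν + 1)) *
        (1 - (q : ℂ)) * (qPochInf (a * b) p / qPochInf a p) * S := by
      field_simp
    _ = (x ^ (ν - γ + 1) * x ^ (γ + ν + 1)) *
        ((u : ℂ) ^ (-γ - 1) * (u : ℂ) ^ (γ + ν + 1)) * (1 - (q : ℂ)) *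
        (((1 - q ^ 2 : ℝ) : ℂ) ^ γ * ((1 - q ^ 2 : ℝ) : ℂ) ^ (1 - (γ + 1))) *
        (qPochInf p p / qPochInf p p) * (qPochInf (a * b) p / qPochInf a p) * S := by
      rw [hpow, hγpow, div_self hP, mul_one, mul_one]
    _ = _ := by ring
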